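/- Suppose p satisfies Z ⊥ C | A. Let Ē : 𝒜 × 𝒵 × 𝒞 → ℝ be any function, let q_Z : 𝒵 × 𝒜 → ℝ satisfy q_Z(z|a) > 0 and Σ_z q_Z(z|a) = 1 for all a, let q_A : 𝒜 × 𝒞 → ℝ satisfy q_A(a|c) > 0 and Σ_a q_A(a|c) = 1 for all c, and let q_C : 𝒞 → ℝ satisfy q_C(c) > 0 and Σ_c q_C(c) = 1. Set θ₀ = Σ_{c,ā,z} E(Y|ā,z,c)·(p(z|a⋆) − p(z|a°))·p(ā|c)·p(c) and define φ̄(c,a,z,y) = (y − Ē(a,z,c))·(q_Z(z|a⋆) − q_Z(z|a°))/q_Z(z|a) + (Σ_{c'} (Σ_ā Ē(ā,z,c')·q_A(ā|c') − Σ_{ā,z'} Ē(ā,z',c')·q_Z(z'|a)·q_A(ā|c'))·q_C(c'))·(1[a=a⋆] − 1[a=a°])/(Σ_{c'} q_A(a|c')·q_C(c')) + Σ_{z'} Ē(a,z',c)·(q_Z(z'|a⋆) − q_Z(z'|a°)) − θ₀. If at least one of the following holds: (i) Ē(a,z,c) = E(Y|a,z,c) for all (a,z,c), q_A(a|c) =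 p(a|c) for all (a,c), and q_C(c) = p(c) for all c; (ii) q_Z(z|a) = p(z|a) for all (z,a) — then E_p(φ̄) = 0. -/

import Mathlib

open Finset

noncomputable section

namespace TwoDoorPaper

/-- Indicator 1[a = b] as a real number. -/
def ind {A : Type*} [DecidableEq A] (a b : A) : ℝ := if a = b then 1 else 0

variable {C A Z Y : Type*} [Fintype C] [Fintype A] [Fintype Z] [Fintype Y]

/-- Marginal p(c). -/
def pC (p : C → A → Z → Y → ℝ) (c : C) : ℝ := ∑ a, ∑ z, ∑ y, p c a z y

/-- Marginal p(a,c). -/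
def pAC (p : C → A → Z → Y → ℝ) (a : A) (c : C) : ℝ := ∑ z, ∑ y, p c a z y

/-- Marginal p(c,a,z). -/
def pCAZ (p : C → A → Z → Y → ℝ) (c : C) (a : A) (z : Z) : ℝ := ∑ y, p c a z y

/-- Marginal p(a). -/
def pA (p : C → A → Z → Y → ℝ) (a : A) : ℝ := ∑ c, pAC p a c

/-- Marginal p(a,z). -/
def pAZ (p : C → A → Z → Y → ℝ) (a : A) (z : Z) : ℝ := ∑ c, pCAZ p c a z

/-- Marginal p(z,c). -/
def pZC (p : C → A → Z → Y → ℝ) (z : Z) (c : C) : ℝ := ∑ a, pCAZ p c a z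

/-- Conditional p(a|c). -/
def cA (p : C → A → Z → Y → ℝ) (a : A) (c : C) : ℝ := pAC p a c / pC p c

/-- Conditional p(z|a,c). -/
def cZ (p : C → A → Z → Y → ℝ) (z : Z) (a : A) (c : C) : ℝ := pCAZ p c a z / pAC p a c

/-- Conditional p(z|a). -/
def cZA (p : C → A → Z → Y → ℝ) (z : Z) (a : A) : ℝ := pAZ p a z / pA p a

/-- Conditional p(y|a,z,c). -/
def cY (p : C → A → Z → Y → ℝ) (a : A) (z : Z) (c : C) (y : Y) : ℝ := p c a z y / pCAZ p c a z

/-- Conditional p(y|a,z). -/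
def cYaz (p : C → A → Z → Y → ℝ) (a : A) (z : Z) (y : Y) : ℝ := (∑ c, p c a z y) / pAZ p a z

/-- Conditional p(y|a,c). -/
def cYac (p : C → A → Z → Y → ℝ) (a : A) (c : C) (y : Y) : ℝ := (∑ z, p c a z y) / pAC p a c

/-- Conditional p(y|z,c). -/
def cYzc (p : C → A → Z → Y → ℝ) (z : Z) (c : C) (y : Y) : ℝ := (∑ a, p c a z y) / pZC p z c

/-- Conditional expectation E(Y|a,z,c). -/
def EYazc (p : C → A → Z → Y → ℝ) (yv : Y → ℝ) (a : A) (z : Z) (c : C) : ℝ :=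
  ∑ y, yv y * cY p a z c y

/-- Conditional variance var(Y|a,z,c). -/
def VYazc (p : C → A → Z → Y → ℝ) (yv : Y → ℝ) (a : A) (z : Z) (c : C) : ℝ :=
  (∑ y, (yv y) ^ 2 * cY p a z c y) - (EYazc p yv a z c) ^ 2

/-- Conditional expectation E(Y|a,z). -/
def EYaz (p : C → A → Z → Y → ℝ) (yv : Y → ℝ) (a : A) (z : Z) : ℝ :=
  ∑ y, yv y * cYaz p a z y

/-- Conditional variance var(Y|a,z). -/
def VYaz (p : C → A → Z → Y → ℝ) (yv : Y → ℝ) (a : A) (z : Z) : ℝ :=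
  (∑ y, (yv y) ^ 2 * cYaz p a z y) - (EYaz p yv a z) ^ 2

/-- Conditional expectation E(Y|a,c). -/
def EYac (p : C → A → Z → Y → ℝ) (yv : Y → ℝ) (a : A) (c : C) : ℝ :=
  ∑ y, yv y * cYac p a c y

/-- Conditional expectation E(Y|z,c). -/
def EYzc (p : C → A → Z → Y → ℝ) (yv : Y → ℝ) (z : Z) (c : C) : ℝ :=
  ∑ y, yv y * cYzc p z c y

/-- Conditional variance var(Y|z,c). -/
def VYzc (p : C → A → Z → Y → ℝ) (yv : Y → ℝ) (z : Z) (c : C) : ℝ :=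
  (∑ y, (yv y) ^ 2 * cYzc p z c y) - (EYzc p yv z c) ^ 2

/-- var(C|a) for real-valued covariates. -/
def VCgivenA (p : C → A → Z → Y → ℝ) (cv : C → ℝ) (a : A) : ℝ :=
  (∑ c, (cv c) ^ 2 * (pAC p a c / pA p a)) - (∑ c, cv c * (pAC p a c / pA p a)) ^ 2

/-- var(Z|a) for real-valued mediators. -/
def VZgivenA (p : C → A → Z → Y → ℝ) (zv : Z → ℝ) (a : A) : ℝ :=
  (∑ z, (zv z) ^ 2 * cZA p z a) - (∑ z, zv z * cZA p z a) ^ 2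

/-- Expectation of f under p. -/
def Ep (p : C → A → Z → Y → ℝ) (f : C → A → Z → Y → ℝ) : ℝ :=
  ∑ c, ∑ a, ∑ z, ∑ y, p c a z y * f c a z y

/-- Variance of f under p. -/
def Varp (p : C → A → Z → Y → ℝ) (f : C → A → Z → Y → ℝ) : ℝ :=
  (∑ c, ∑ a, ∑ z, ∑ y, p c a z y * (f c a z y) ^ 2) - (Ep p f) ^ 2

/-- p is a strictly positive probability mass function. -/
def IsPMF (p : C → A → Z → Y → ℝ) : Prop :=
  (∀ c a z y, 0 < p c a z y) ∧ (∑ c, ∑ a, ∑ z, ∑ y, p c a z y) = 1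

/-- Y ⊥ A | (Z, C): p(y|a,z,c) does not depend on a. -/
def IndepYA (p : C → A → Z → Y → ℝ) : Prop :=
  ∀ a a' z c y, cY p a z c y = cY p a' z c y

/-- Z ⊥ C | A: p(z|a,c) = p(z|a) for all c. -/
def IndepZC (p : C → A → Z → Y → ℝ) : Prop :=
  ∀ z a c, cZ p z a c = cZA p z a

/-- θ_td. -/
def thTD (p : C → A → Z → Y → ℝ) (yv : Y → ℝ) (astar acirc : A) : ℝ :=
  ∑ z, ∑ c, ∑ ab, EYazc p yv ab z c * (cZ p z astar c - cZ p z acirc c) * cA p ab c * pC p c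

/-- The two-door efficient influence function φ_td. -/
def phiTD [DecidableEq A] (p : C → A → Z → Y → ℝ) (yv : Y → ℝ) (astar acirc : A)
    (c : C) (a : A) (z : Z) (y : Y) : ℝ :=
  (yv y - EYazc p yv a z c) * (cZ p z astar c - cZ p z acirc c) / cZ p z a c
  + ((∑ ab, EYazc p yv ab z c * cA p ab c)
      - ∑ ab, ∑ z', EYazc p yv ab z' c * cZ p z' a c * cA p ab c)
    * (ind a astar - ind a acirc) / cA p a c
  + (∑ z', EYazc p yv a z' c * (cZ p z' astar c - cZ p z' acirc c))
  - thTD p yv astar acirc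

/-- θ_bd. -/
def thBD (p : C → A → Z → Y → ℝ) (yv : Y → ℝ) (astar acirc : A) : ℝ :=
  ∑ c, pC p c * (EYac p yv astar c - EYac p yv acirc c)

/-- The back-door efficient influence function φ_bd. -/
def phiBD [DecidableEq A] (p : C → A → Z → Y → ℝ) (yv : Y → ℝ) (astar acirc : A)
    (c : C) (a : A) (_z : Z) (y : Y) : ℝ :=
  ind a astar * (yv y - EYac p yv astar c) / cA p astar c
  - ind a acirc * (yv y - EYac p yv acirc c) / cA p acirc c
  + EYac p yv astar c - EYac p yv acirc c - thBD p yv astar acirc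

/-- θ° (for the combined back-door/two-door model). -/
def thBDTD (p : C → A → Z → Y → ℝ) (yv : Y → ℝ) (astar acirc : A) : ℝ :=
  ∑ z, ∑ c, EYzc p yv z c * (cZ p z astar c - cZ p z acirc c) * pC p c

/-- The efficient influence function φ_bdtd. -/
def phiBDTD [DecidableEq A] (p : C → A → Z → Y → ℝ) (yv : Y → ℝ) (astar acirc : A)
    (c : C) (a : A) (z : Z) (y : Y) : ℝ :=
  (yv y - EYzc p yv z c) * (cZ p z astar c - cZ p z acirc c) / (∑ ab, cZ p z ab c * cA p ab c)
  + (EYzc p yv z c - ∑ z', EYzc p yv z' c * cZ p z' a c)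
    * (ind a astar - ind a acirc) / cA p a c
  + (∑ z', EYzc p yv z' c * (cZ p z' astar c - cZ p z' acirc c))
  - thBDTD p yv astar acirc

/-- ψ_fd(ă). -/
def psiFD (p : C → A → Z → Y → ℝ) (yv : Y → ℝ) (abreve : A) : ℝ :=
  ∑ z, ∑ ab, EYaz p yv ab z * pA p ab * cZA p z abreve

/-- θ_fd. -/
def thFD (p : C → A → Z → Y → ℝ) (yv : Y → ℝ) (astar acirc : A) : ℝ :=
  psiFD p yv astar - psiFD p yv acirc

/-- The front-door efficient influence function φ_fd. -/
def phiFD [DecidableEq A] (p : C → A → Z → Y → ℝ) (yv : Y → ℝ) (astar acirc : A)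
    (_c : C) (a : A) (z : Z) (y : Y) : ℝ :=
  (yv y - EYaz p yv a z) * (cZA p z astar - cZA p z acirc) / cZA p z a
  + ind a astar * ((∑ ab, EYaz p yv ab z * pA p ab) - psiFD p yv astar) / pA p astar
  - ind a acirc * ((∑ ab, EYaz p yv ab z * pA p ab) - psiFD p yv acirc) / pA p acirc
  + (∑ z', EYaz p yv a z' * (cZA p z' astar - cZA p z' acirc))
  - thFD p yv astar acirc

/-- θ' (for the combined front-door/two-door model). -/
def thFDTD (p : C → A → Z → Y → ℝ) (yv : Y → ℝ) (astar acirc : A) : ℝ :=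
  ∑ c, ∑ ab, ∑ z, EYazc p yv ab z c * (cZA p z astar - cZA p z acirc) * cA p ab c * pC p c

/-- The efficient influence function φ_fdtd. -/
def phiFDTD [DecidableEq A] (p : C → A → Z → Y → ℝ) (yv : Y → ℝ) (astar acirc : A)
    (c : C) (a : A) (z : Z) (y : Y) : ℝ :=
  (yv y - EYazc p yv a z c) * (cZA p z astar - cZA p z acirc) / cZA p z a
  + (∑ c', ((∑ ab, EYazc p yv ab z c' * cA p ab c')
        - ∑ ab, ∑ z', EYazc p yv ab z' c' * cZA p z' a * cA p ab c') * pC p c')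
    * (ind a astar - ind a acirc) / pA p a
  + (∑ z', EYazc p yv a z' c * (cZA p z' astar - cZA p z' acirc))
  - thFDTD p yv astar acirc

/-- θ'' (for the combined back/front/two-door model). -/
def thBDFDTD (p : C → A → Z → Y → ℝ) (yv : Y → ℝ) (astar acirc : A) : ℝ :=
  ∑ c, ∑ z, EYzc p yv z c * (cZA p z astar - cZA p z acirc) * pC p c

/-- The efficient influence function φ_bdfdtd. -/
def phiBDFDTD [DecidableEq A] (p : C → A → Z → Y → ℝ) (yv : Y → ℝ) (astar acirc : A)
    (c : C) (a : A) (z : Z) (y : Y) : ℝ :=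
  (yv y - EYzc p yv z c) * (cZA p z astar - cZA p z acirc) / (∑ ab, cA p ab c * cZA p z ab)
  + (∑ c', (EYzc p yv z c' - ∑ z', EYzc p yv z' c' * cZA p z' a) * pC p c')
    * (ind a astar - ind a acirc) / (∑ c', pC p c' * cA p a c')
  + (∑ z', EYzc p yv z' c * (cZA p z' astar - cZA p z' acirc))
  - thBDFDTD p yv astar acirc


section Expectation

variable {p : C → A → Z → Y → ℝ}

lemma pCAZ_pos [Nonempty Y] (hp : IsPMF p) (c : C) (a : A) (z : Z) : 0 < pCAZ p c a z :=
  sum_pos (fun y _ => hp.1 c a z y) univ_nonempty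

lemma pAC_pos [Nonempty Z] [Nonempty Y] (hp : IsPMF p) (a : A) (c : C) : 0 < pAC p a c :=
  sum_pos (fun z _ => pCAZ_pos hp c a z) univ_nonempty

lemma pC_pos [Nonempty A] [Nonempty Z] [Nonempty Y] (hp : IsPMF p) (c : C) : 0 < pC p c :=
  sum_pos (fun a _ => pAC_pos hp a c) univ_nonempty

lemma pA_pos [Nonempty C] [Nonempty Z] [Nonempty Y] (hp : IsPMF p) (a : A) : 0 < pA p a :=
  sum_pos (fun c _ => pAC_pos hp a c) univ_nonempty

lemma cA_mul_pC [Nonempty A] [Nonempty Z] [Nonempty Y] (hp : IsPMF p) (a : A) (c : C) :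
    cA p a c * pC p c = pAC p a c :=
  div_mul_cancel₀ _ (pC_pos hp c).ne'

lemma pCAZ_eq_pAC_mul_cZA [Nonempty Z] [Nonempty Y] (hp : IsPMF p) (hzc : IndepZC p)
    (c : C) (a : A) (z : Z) : pCAZ p c a z = pAC p a c * cZA p z a := by
  rw [← hzc z a c, cZ, mul_div_cancel₀ _ (pAC_pos hp a c).ne']

lemma sum_cZA [Nonempty C] [Nonempty Z] [Nonempty Y] (hp : IsPMF p) (a : A) :
    ∑ z, cZA p z a = 1 := by
  have h : ∑ z, pAZ p a z = pA p a := by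
    simp only [pAZ, pA, pAC, pCAZ]
    exact sum_comm
  simp only [cZA]
  rw [← sum_div, h, div_self (pA_pos hp a).ne']

lemma sum_mul_outcome [Nonempty Y] (hp : IsPMF p) (yv : Y → ℝ) (c : C) (a : A) (z : Z) :
    ∑ y, p c a z y * yv y = pCAZ p c a z * EYazc p yv a z c := by
  rw [EYazc, mul_sum]
  refine sum_congr rfl fun y _ => ?_
  have := (pCAZ_pos hp c a z).ne'
  rw [cY]
  field_simp

/-- Under `Z ⊥ C | A`, expectation of a function affine in the outcome. -/
lemma Ep_affine [Nonempty Z] [Nonempty Y] (hp : IsPMF p) (hzc : IndepZC p) (yv : Y → ℝ)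
    (u v : C → A → Z → ℝ) :
    Ep p (fun c a z y => yv y * u c a z + v c a z)
      = ∑ c, ∑ a, pAC p a c * ∑ z, cZA p z a * (EYazc p yv a z c * u c a z + v c a z) := by
  refine sum_congr rfl fun c _ => sum_congr rfl fun a _ => ?_
  rw [mul_sum]
  refine sum_congr rfl fun z _ => ?_
  have h1 : ∑ y, p c a z y * (yv y * u c a z + v c a z)
      = (∑ y, p c a z y * yv y) * u c a z + pCAZ p c a z * v c a z := by
    rw [pCAZ, sum_mul, sum_mul, ← sum_add_distrib]
    exact sum_congr rfl fun y _ => by ring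
  rw [h1, sum_mul_outcome hp, pCAZ_eq_pAC_mul_cZA hp hzc]
  ring

lemma sum_pAC (hp : IsPMF p) : ∑ c, ∑ a, pAC p a c = 1 := hp.2

lemma thFDTD_eq [Nonempty A] [Nonempty Z] [Nonempty Y] (hp : IsPMF p) (yv : Y → ℝ)
    (astar acirc : A) :
    thFDTD p yv astar acirc
      = ∑ c, ∑ a, pAC p a c
          * ∑ z, EYazc p yv a z c * (cZA p z astar - cZA p z acirc) := by
  refine sum_congr rfl fun c _ => sum_congr rfl fun a _ => ?_
  rw [mul_sum]
  refine sum_congr rfl fun z _ => ?_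
  rw [← cA_mul_pC hp]
  ring

lemma sum_ind_sub_mul [DecidableEq A] (a₁ a₂ : A) (f : A → ℝ) :
    ∑ a, (ind a a₁ - ind a a₂) * f a = f a₁ - f a₂ := by
  simp [ind, sub_mul, sum_sub_distrib]

end Expectation

/-- Averaging a working outcome model over covariates and treatment; the working mediator model
enters the centred version only through a mean of this average. -/
lemma sum_centred_eq (Eb : A → Z → C → ℝ) (qZ : Z → A → ℝ) (qA : A → C → ℝ) (qC : C → ℝ)
    (z : Z) (a : A) :
    (∑ c', ((∑ ab, Eb ab z c' * qA ab c')
        - ∑ ab, ∑ z', Eb ab z' c' * qZ z' a * qA ab c') * qC c')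
      = (∑ c, ∑ ab, Eb ab z c * (qA ab c * qC c))
        - ∑ z', qZ z' a * ∑ c, ∑ ab, Eb ab z' c * (qA ab c * qC c) := by
  simp only [sub_mul, sum_sub_distrib, sum_mul, mul_sum]
  congr 1
  · exact sum_congr rfl fun c _ => sum_congr rfl fun ab _ => by ring
  · rw [sum_comm]
    refine Eq.trans ?_ sum_comm
    rw [sum_comm]
    refine sum_congr rfl fun c _ => ?_
    rw [sum_comm]
    exact sum_congr rfl fun z' _ => sum_congr rfl fun ab _ => by ring

/-- Robustness of the estimating equation based on φ_fdtd to misspecified nuisance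
models (Theorem 3, consistency part). -/
theorem stmt17
    {C A Z Y : Type*} [Fintype C] [Fintype A] [Fintype Z] [Fintype Y]
    [Nonempty C] [Nonempty A] [Nonempty Z] [Nonempty Y] [DecidableEq A]
    (p : C → A → Z → Y → ℝ) (yv : Y → ℝ) (hyv : Function.Injective yv)
    (hp : IsPMF p) (astar acirc : A) (hne : astar ≠ acirc)
    (hzc : IndepZC p)
    (Eb : A → Z → C → ℝ)
    (qZ : Z → A → ℝ) (hqZpos : ∀ z a, 0 < qZ z a) (hqZsum : ∀ a, (∑ z, qZ z a) = 1)
    (qA : A → C → ℝ) (hqApos : ∀ a c, 0 < qA a c) (hqAsum : ∀ c, (∑ a, qA a c) = 1)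
    (qC : C → ℝ) (hqCpos : ∀ c, 0 < qC c) (hqCsum : (∑ c, qC c) = 1)
    (hcase :
      ((∀ a z c, Eb a z c = EYazc p yv a z c) ∧ (∀ a c, qA a c = cA p a c)
          ∧ (∀ c, qC c = pC p c))
      ∨ (∀ z a, qZ z a = cZA p z a)) :
    Ep p (fun c a z y =>
      (yv y - Eb a z c) * (qZ z astar - qZ z acirc) / qZ z a
      + (∑ c', ((∑ ab, Eb ab z c' * qA ab c')
            - ∑ ab, ∑ z', Eb ab z' c' * qZ z' a * qA ab c') * qC c')
        * (ind a astar - ind a acirc) / (∑ c', qA a c' * qC c')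
      + (∑ z', Eb a z' c * (qZ z' astar - qZ z' acirc))
      - thFDTD p yv astar acirc) = 0 := by
  set D : Z → ℝ := fun z => qZ z astar - qZ z acirc with hD
  set G : Z → ℝ := fun z => ∑ c, ∑ ab, Eb ab z c * (qA ab c * qC c) with hG
  set T := thFDTD p yv astar acirc with hT
  have hform : (fun c a z y =>
      (yv y - Eb a z c) * (qZ z astar - qZ z acirc) / qZ z a
      + (∑ c', ((∑ ab, Eb ab z c' * qA ab c')
            - ∑ ab, ∑ z', Eb ab z' c' * qZ z' a * qA ab c') * qC c')
        * (ind a astar - ind a acirc) / (∑ c', qA a c' * qC c')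
      + (∑ z', Eb a z' c * (qZ z' astar - qZ z' acirc))
      - T)
      = fun c a z y => yv y * (D z / qZ z a)
        + ((G z - ∑ z', qZ z' a * G z')
            * ((ind a astar - ind a acirc) / ∑ c', qA a c' * qC c')
          + (∑ z', Eb a z' c * D z') - T - Eb a z c * (D z / qZ z a)) := by
    funext c a z y
    rw [sum_centred_eq]
    ring
  rw [hform, Ep_affine hp hzc yv (fun _ a z => D z / qZ z a) (fun c a z =>
    (G z - ∑ z', qZ z' a * G z') * ((ind a astar - ind a acirc) / ∑ c', qA a c' * qC c')
      + (∑ z', Eb a z' c * D z') - T - Eb a z c * (D z / qZ z a))]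
  have hinner : ∀ c a, ∑ z, cZA p z a * (EYazc p yv a z c * (D z / qZ z a)
      + ((G z - ∑ z', qZ z' a * G z')
            * ((ind a astar - ind a acirc) / ∑ c', qA a c' * qC c')
          + (∑ z', Eb a z' c * D z') - T - Eb a z c * (D z / qZ z a)))
      = (∑ z, cZA p z a * ((EYazc p yv a z c - Eb a z c) * (D z / qZ z a)))
        + ((∑ z, cZA p z a * G z) - ∑ z, qZ z a * G z)
            * ((ind a astar - ind a acirc) / ∑ c', qA a c' * qC c')
        + (∑ z, Eb a z c * D z) - T := by
    intro c a
    generalize (ind a astar - ind a acirc) / ∑ c', qA a c' * qC c' = S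
    generalize hH : ∑ z', qZ z' a * G z' = H
    generalize ∑ z', Eb a z' c * D z' = M
    have h1 : ∀ x : ℝ, x = ∑ z, cZA p z a * x := fun x => by
      rw [← sum_mul, sum_cZA hp, one_mul]
    rw [sub_mul, add_sub_assoc, add_assoc]
    rw [show ∀ x y w : ℝ, x + (y * S - H * S + (w - T)) = x + y * S + (w - T - H * S) from
      fun _ _ _ => by ring, h1 (M - T - H * S), sum_mul, ← sum_add_distrib, ← sum_add_distrib]
    exact sum_congr rfl fun z _ => by ring
  simp only [hinner]
  rcases hcase with ⟨hE, hqA, hqC⟩ | hZ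
  · have hw : ∀ a c, qA a c * qC c = pAC p a c := fun a c => by
      rw [hqA, hqC, cA_mul_pC hp]
    have hGE : ∀ f : Z → ℝ, ∑ c, ∑ a, pAC p a c * ∑ z, Eb a z c * f z = ∑ z, G z * f z := by
      intro f
      simp only [hG, hw, sum_mul, mul_sum]
      refine (sum_congr rfl fun c _ => sum_comm).trans (sum_comm.trans ?_)
      exact sum_congr rfl fun z _ => sum_congr rfl fun c _ => sum_congr rfl fun a _ => by ring
    have hTG : T = ∑ z, G z * (cZA p z astar - cZA p z acirc) := by
      rw [← hGE, hT, thFDTD_eq hp]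
      simp only [hE]
    have hmid : ∑ c, ∑ a, pAC p a c * (((∑ z, cZA p z a * G z) - ∑ z, qZ z a * G z)
        * ((ind a astar - ind a acirc) / ∑ c', qA a c' * qC c'))
        = ((∑ z, cZA p z astar * G z) - ∑ z, qZ z astar * G z)
          - ((∑ z, cZA p z acirc * G z) - ∑ z, qZ z acirc * G z) := by
      rw [← sum_ind_sub_mul astar acirc
        (fun a => (∑ z, cZA p z a * G z) - ∑ z, qZ z a * G z), sum_comm]
      refine sum_congr rfl fun a _ => ?_
      have hpa : ∑ c', pAC p a c' = pA p a := rfl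
      have hpos := (pA_pos hp a).ne'
      simp only [hw]
      rw [← sum_mul, hpa]
      field_simp
    simp only [← hE, sub_self, zero_mul, mul_zero, sum_const_zero, zero_add]
    simp only [mul_sub (pAC p _ _), mul_add (pAC p _ _), sum_add_distrib, sum_sub_distrib]
    rw [hmid, hGE]
    simp only [← sum_mul]
    rw [sum_pAC hp, one_mul, hTG]
    simp only [hD, mul_comm (G _), sub_mul, sum_sub_distrib]
    ring
  · have hq : ∀ a c, ∑ z, cZA p z a * ((EYazc p yv a z c - Eb a z c) * (D z / qZ z a))
        = ∑ z, EYazc p yv a z c * D z - ∑ z, Eb a z c * D z := by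
      intro a c
      rw [← sum_sub_distrib]
      refine sum_congr rfl fun z _ => ?_
      have := (hqZpos z a).ne'
      rw [← hZ]
      field_simp
    have hTD : T = ∑ c, ∑ a, pAC p a c * ∑ z, EYazc p yv a z c * D z := by
      rw [hT, thFDTD_eq hp]
      simp only [hD, hZ]
    simp only [hq]
    simp only [← hZ, sub_self, zero_mul, add_zero, sub_add_cancel, mul_sub, sum_sub_distrib,
      ← sum_mul]
    rw [← hTD, sum_pAC hp, one_mul, sub_self]

end TwoDoorPaper
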